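/- arXiv:2308.12693 — 6 statements merged into one kernel-verified Lean document; each statement's English description precedes it below -/
import Mathlib

section
/- Let x and y be permutations on I. Then x is subordinate to y (i.e., S^x_{2i-1} ∈ {S^y_{2i-1}, S^y_{2i}} for every 1 ≤ i ≤ k) if and only if there exists a unique pair (τ, σ) ∈ S^even_{2k} × S^odd_{2k} such that τ·σ·x = y. -/
noncomputable section

/-- A permutation on `I`: an injective `2*k`-tuple with values in `I`
(for `|I| = 2*k` this is exactly a bijection from `{1,…,2k}` to `I`). -/
def PermOn (k : ℕ) (I : Finset ℕ) : Type :=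
  {x : Fin (2 * k) → ℕ // Function.Injective x ∧ ∀ i, x i ∈ I}

/-- The set `S^x_i`, with `0`-based index `j` (so `j = i - 1`). -/
def Sset (k : ℕ) (x : Fin (2 * k) → ℕ) (j : Fin (2 * k)) : Finset ℕ :=
  insert (x j)
    ((Finset.univ.filter (fun t : Fin (2 * k) => (t : ℕ) < 2 * ((j : ℕ) / 2))).image x)

/-- `x` is subordinate to `y`: `S^x_{2i-1} ∈ {S^y_{2i-1}, S^y_{2i}}` for all `1 ≤ i ≤ k`. -/
def Subordinate (k : ℕ) (x y : Fin (2 * k) → ℕ) : Prop :=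
  ∀ i : ℕ, ∀ h : i < k,
    Sset k x ⟨2 * i, by omega⟩ = Sset k y ⟨2 * i, by omega⟩ ∨
    Sset k x ⟨2 * i, by omega⟩ = Sset k y ⟨2 * i + 1, by omega⟩

/-- Alternating permutation. -/
def IsAlt (k : ℕ) (x : Fin (2 * k) → ℕ) : Prop :=
  (∀ i : ℕ, ∀ h : i < k, x ⟨2 * i, by omega⟩ < x ⟨2 * i + 1, by omega⟩) ∧
  (∀ i : ℕ, ∀ h : i + 1 < k, x ⟨2 * i + 2, by omega⟩ < x ⟨2 * i + 1, by omega⟩)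

/-- Sum of the `m`-th block (0-based). -/
def blockSum (k : ℕ) (x : Fin (2 * k) → ℕ) (m : ℕ) (h : m < k) : ℕ :=
  x ⟨2 * m, by omega⟩ + x ⟨2 * m + 1, by omega⟩

/-- The order `≺`: lexicographic on block sums read from the last block. -/
def PermLt (k : ℕ) (x y : Fin (2 * k) → ℕ) : Prop :=
  ∃ j : ℕ, ∃ hj : j < k,
    blockSum k x (k - 1 - j) (by omega) < blockSum k y (k - 1 - j) (by omega) ∧
    ∀ i : ℕ, i < j →
      blockSum k x (k - 1 - i) (by omega) = blockSum k y (k - 1 - i) (by omega)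

/-- The subgroup `S^even_{2k}` generated by the transpositions `(2i-1, 2i)`, `1 ≤ i ≤ k`. -/
def Seven (k : ℕ) : Subgroup (Equiv.Perm (Fin (2 * k))) :=
  Subgroup.closure
    { σ | ∃ (i : ℕ) (h : i < k),
        σ = Equiv.swap (⟨2 * i, by omega⟩ : Fin (2 * k)) ⟨2 * i + 1, by omega⟩ }

/-- The subgroup `S^odd_{2k}` generated by the transpositions `(2i, 2i+1)`, `1 ≤ i ≤ k-1`. -/
def Sodd (k : ℕ) : Subgroup (Equiv.Perm (Fin (2 * k))) :=
  Subgroup.closure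
    { σ | ∃ (i : ℕ) (h : i + 1 < k),
        σ = Equiv.swap (⟨2 * i + 1, by omega⟩ : Fin (2 * k)) ⟨2 * i + 2, by omega⟩ }

/-- `set4 k x i p q r s` agrees with `x` except at the (0-based) positions
`2i, 2i+1, 2i+2, 2i+3`, where it takes the values `p, q, r, s`. -/
def set4 (k : ℕ) (x : Fin (2 * k) → ℕ) (i : ℕ) (p q r s : ℕ) : Fin (2 * k) → ℕ :=
  fun j =>
    if (j : ℕ) = 2 * i then p
    else if (j : ℕ) = 2 * i + 1 then q
    else if (j : ℕ) = 2 * i + 2 then r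
    else if (j : ℕ) = 2 * i + 3 then s
    else x j

/-- Generators of type (1): `x + x'` where `x'` interchanges the two values of a block of `x`. -/
def SwapSet (k : ℕ) (I : Finset ℕ) : Set (PermOn k I →₀ ℚ) :=
  { v | ∃ (x x' : PermOn k I) (i : ℕ) (h : i < k),
      x'.1 = x.1 ∘ (Equiv.swap (⟨2 * i, by omega⟩ : Fin (2 * k)) ⟨2 * i + 1, by omega⟩) ∧
      v = Finsupp.single x 1 + Finsupp.single x' 1 }

/-- Generators of type (2): the Garnir elements
`x(ab/cd) − x(ac/bd) + x(ad/bc) + x(bc/ad) − x(bd/ac) + x(cd/ab)`. -/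
def GarnirSet (k : ℕ) (I : Finset ℕ) : Set (PermOn k I →₀ ℚ) :=
  { v | ∃ (x y₁ y₂ y₃ y₄ y₅ : PermOn k I) (i : ℕ) (h : i + 1 < k),
      (y₁.1 = set4 k x.1 i (x.1 ⟨2 * i, by omega⟩) (x.1 ⟨2 * i + 2, by omega⟩)
          (x.1 ⟨2 * i + 1, by omega⟩) (x.1 ⟨2 * i + 3, by omega⟩) ∧
       y₂.1 = set4 k x.1 i (x.1 ⟨2 * i, by omega⟩) (x.1 ⟨2 * i + 3, by omega⟩)
          (x.1 ⟨2 * i + 1, by omega⟩) (x.1 ⟨2 * i + 2, by omega⟩) ∧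
       y₃.1 = set4 k x.1 i (x.1 ⟨2 * i + 1, by omega⟩) (x.1 ⟨2 * i + 2, by omega⟩)
          (x.1 ⟨2 * i, by omega⟩) (x.1 ⟨2 * i + 3, by omega⟩) ∧
       y₄.1 = set4 k x.1 i (x.1 ⟨2 * i + 1, by omega⟩) (x.1 ⟨2 * i + 3, by omega⟩)
          (x.1 ⟨2 * i, by omega⟩) (x.1 ⟨2 * i + 2, by omega⟩) ∧
       y₅.1 = set4 k x.1 i (x.1 ⟨2 * i + 2, by omega⟩) (x.1 ⟨2 * i + 3, by omega⟩)
          (x.1 ⟨2 * i, by omega⟩) (x.1 ⟨2 * i + 1, by omega⟩)) ∧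
      v = Finsupp.single x 1 - Finsupp.single y₁ 1 + Finsupp.single y₂ 1
          + Finsupp.single y₃ 1 - Finsupp.single y₄ 1 + Finsupp.single y₅ 1 }

/-- The subspace `M_I` of `ℚ⟨Perm_I⟩`. -/
def MI (k : ℕ) (I : Finset ℕ) : Submodule ℚ (PermOn k I →₀ ℚ) :=
  Submodule.span ℚ (SwapSet k I ∪ GarnirSet k I)

/-- The simplex `φ_I(x) = {S^x_1, S^x_3, …, S^x_{2k-1}}`. -/
def phiMap (k : ℕ) (x : Fin (2 * k) → ℕ) : Finset (Finset ℕ) :=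
  Finset.univ.image (fun i : Fin k => Sset k x ⟨2 * (i : ℕ), by have := i.isLt; omega⟩)

/-- The face `F(x, ε) = {S^x_{2i-1+ε_i} : 1 ≤ i ≤ k}`. -/
def Fface (k : ℕ) (x : Fin (2 * k) → ℕ) (ε : Fin k → Bool) : Finset (Finset ℕ) :=
  Finset.univ.image (fun i : Fin k =>
    Sset k x ⟨2 * (i : ℕ) + (if ε i then 1 else 0), by have := i.isLt; split <;> omega⟩)

/-- The chain `c(x) = Σ_ε (−1)^{ε_1+⋯+ε_k} e_{F(x,ε)}`. -/
def chain (k : ℕ) (x : Fin (2 * k) → ℕ) : Finset (Finset ℕ) →₀ ℚ :=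
  ∑ ε : Fin k → Bool,
    ((-1 : ℚ) ^ (∑ i : Fin k, (ε i).toNat)) • Finsupp.single (Fface k x ε) 1

/-- Directed walks from `α` to `x`, encoded as `(m, v)` with `v : Fin (m+1) → Perm_I`. -/
def Walks (k : ℕ) (I : Finset ℕ) (α x : PermOn k I) :
    Set ((m : ℕ) × (Fin (m + 1) → PermOn k I)) :=
  { w | 1 ≤ w.1 ∧ w.2 0 = α ∧ w.2 (Fin.last w.1) = x ∧
      (∀ j : ℕ, ∀ h : j < w.1,
        IsAlt k (w.2 ⟨j, by omega⟩).1 ∧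
        Subordinate k (w.2 ⟨j, by omega⟩).1 (w.2 ⟨j + 1, by omega⟩).1) ∧
      (∀ j : ℕ, ∀ h : j + 1 < w.1, w.2 ⟨j, by omega⟩ ≠ w.2 ⟨j + 1, by omega⟩) }

/-- `s_I(α, x) = 1` if the unique `τ ∈ S^even_{2k}` with `τ·σ·α = x` is an even
permutation, and `0` otherwise. -/
def sI (k : ℕ) (I : Finset ℕ) (α x : PermOn k I) : ℕ := by
  classical
  exact if (∃ (τ : Seven k) (σ : Sodd k),
      (∀ j, α.1 (σ.1 (τ.1 j)) = x.1 j) ∧ Equiv.Perm.sign τ.1 = 1)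
    then 1 else 0

/-- The weight `wt` of a walk. -/
def wtW (k : ℕ) (I : Finset ℕ) (w : (m : ℕ) × (Fin (m + 1) → PermOn k I)) : ℕ :=
  ∑ j : Fin w.1, sI k I (w.2 j.castSucc) (w.2 j.succ)

/-- The topological coefficient `TCoef^α_x = −Σ_{p ∈ P_I(α,x)} (−1)^{wt(p)}`. -/
def TCoef (k : ℕ) (I : Finset ℕ) (α x : PermOn k I) : ℚ :=
  - ∑ᶠ p ∈ Walks k I α x, (-1 : ℚ) ^ (wtW k I p)

/-- `z` is restrictable to `I₁` and `I₂`. -/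
def Restrictable (k l : ℕ) (I₁ I₂ : Finset ℕ) (z : Fin (2 * (k + l)) → ℕ) : Prop :=
  ∀ i : ℕ, ∀ h : i < k + l,
    (z ⟨2 * i, by omega⟩ ∈ I₁ ∧ z ⟨2 * i + 1, by omega⟩ ∈ I₁) ∨
    (z ⟨2 * i, by omega⟩ ∈ I₂ ∧ z ⟨2 * i + 1, by omega⟩ ∈ I₂)

/-- The map `Perm_I → Perm_{w(I)}`, `x ↦ w ∘ x`. -/
def wMap (k : ℕ) (I : Finset ℕ) (w : Equiv.Perm ℕ) (x : PermOn k I) :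
    PermOn k (I.image w) :=
  ⟨fun j => w (x.1 j),
   fun a b hab => x.2.1 (w.injective hab),
   fun j => Finset.mem_image_of_mem w (x.2.2 j)⟩

end

theorem mem_Seven_iff {k : ℕ} {π : Equiv.Perm (Fin (2 * k))} :
    π ∈ Seven k ↔ ∀ j, (π j : ℕ) / 2 = (j : ℕ) / 2 := by
  constructor
  · intro h
    induction h using Subgroup.closure_induction with
    | mem π hπ =>
      obtain ⟨i, h, rfl⟩ := hπ
      intro j
      rw [Equiv.swap_apply_def]
      split_ifs <;> simp_all <;> omega
    | one => simp
    | mul a b _ _ ha hb => intro j; rw [Equiv.Perm.mul_apply, ha, hb]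
    | inv a _ ha => intro j; simpa using (ha (a⁻¹ j)).symm
  · intro h
    refine (mem_closure_isSwap ?_).2 ⟨Set.toFinite _, fun j => ?_⟩
    · rintro _ ⟨i, h, rfl⟩
      exact ⟨_, _, by simp, rfl⟩
    · have hj := h j
      have hlt := (π j).isLt
      have hi : (j : ℕ) / 2 < k := by omega
      by_cases he : π j = j
      · rw [he]
        exact MulAction.mem_orbit_self j
      · refine ⟨⟨_, Subgroup.subset_closure ⟨(j : ℕ) / 2, hi, rfl⟩⟩, ?_⟩
        rw [Fin.ext_iff] at he
        simp only [Subgroup.mk_smul, Equiv.Perm.smul_def, Equiv.swap_apply_def, Fin.ext_iff]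
        split_ifs <;> (try dsimp only) <;> omega

theorem mem_Sodd_iff {k : ℕ} {π : Equiv.Perm (Fin (2 * k))} :
    π ∈ Sodd k ↔ ∀ j, ((π j : ℕ) + 1) / 2 = ((j : ℕ) + 1) / 2 := by
  constructor
  · intro h
    induction h using Subgroup.closure_induction with
    | mem π hπ =>
      obtain ⟨i, h, rfl⟩ := hπ
      intro j
      rw [Equiv.swap_apply_def]
      split_ifs <;> simp_all <;> omega
    | one => simp
    | mul a b _ _ ha hb => intro j; rw [Equiv.Perm.mul_apply, ha, hb]
    | inv a _ ha => intro j; simpa using (ha (a⁻¹ j)).symm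
  · intro h
    refine (mem_closure_isSwap ?_).2 ⟨Set.toFinite _, fun j => ?_⟩
    · rintro _ ⟨i, h, rfl⟩
      exact ⟨_, _, by simp, rfl⟩
    · have hj := h j
      have hlt := (π j).isLt
      by_cases he : π j = j
      · rw [he]
        exact MulAction.mem_orbit_self j
      · rw [Fin.ext_iff] at he
        have hi : ((j : ℕ) - 1) / 2 + 1 < k := by omega
        refine ⟨⟨_, Subgroup.subset_closure ⟨((j : ℕ) - 1) / 2, hi, rfl⟩⟩, ?_⟩
        simp only [Subgroup.mk_smul, Equiv.Perm.smul_def, Equiv.swap_apply_def, Fin.ext_iff]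
        split_ifs <;> (try dsimp only) <;> omega

theorem disjoint_Seven_Sodd (k : ℕ) : Disjoint (Seven k) (Sodd k) := by
  rw [Subgroup.disjoint_def]
  intro π h₁ h₂
  ext j
  have := mem_Seven_iff.1 h₁ j
  have := mem_Sodd_iff.1 h₂ j
  rw [Equiv.Perm.one_apply]
  omega

theorem mem_Sset {k : ℕ} {x : Fin (2 * k) → ℕ} {j : Fin (2 * k)} {a : ℕ} :
    a ∈ Sset k x j ↔ ∃ t, (t = j ∨ (t : ℕ) / 2 < (j : ℕ) / 2) ∧ x t = a := by
  have h (t : Fin (2 * k)) : (t : ℕ) < 2 * ((j : ℕ) / 2) ↔ (t : ℕ) / 2 < (j : ℕ) / 2 := by omega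
  simp [Sset, h, or_and_right, exists_or, eq_comm]

theorem Sset_comp_of_mem_Seven {k : ℕ} (z : Fin (2 * k) → ℕ) {τ : Equiv.Perm (Fin (2 * k))}
    (hτ : τ ∈ Seven k) (j : Fin (2 * k)) : Sset k (z ∘ τ) j = Sset k z (τ j) := by
  ext a
  rw [iff_comm, mem_Sset, τ.surjective.exists, mem_Sset]
  simp only [mem_Seven_iff.1 hτ, τ.injective.eq_iff, Function.comp_apply]

theorem Sset_comp_even_eq_iff {k : ℕ} {x : Fin (2 * k) → ℕ} (hx : Function.Injective x)
    (π : Equiv.Perm (Fin (2 * k))) {i : ℕ} (hi : 2 * i < 2 * k) :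
    Sset k (x ∘ π) ⟨2 * i, hi⟩ = Sset k x ⟨2 * i, hi⟩ ↔
      ∀ t : Fin (2 * k), (t : ℕ) ≤ 2 * i ↔ (π t : ℕ) ≤ 2 * i := by
  have h (t : Fin (2 * k)) :
      (t = ⟨2 * i, hi⟩ ∨ (t : ℕ) / 2 < 2 * i / 2) ↔ (t : ℕ) ≤ 2 * i := by
    rw [Fin.ext_iff]
    simp only
    omega
  simp only [Finset.ext_iff, mem_Sset, h, Function.comp_apply]
  constructor
  · intro H t
    simpa [hx.eq_iff] using H (x (π t))
  · intro H a
    rw [iff_comm, π.surjective.exists]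
    exact exists_congr fun t => and_congr_left' (H t).symm

theorem mem_Sodd_iff_Sset_comp_eq {k : ℕ} {x : Fin (2 * k) → ℕ} (hx : Function.Injective x)
    {π : Equiv.Perm (Fin (2 * k))} :
    π ∈ Sodd k ↔ ∀ i, ∀ h : i < k,
      Sset k (x ∘ π) ⟨2 * i, by omega⟩ = Sset k x ⟨2 * i, by omega⟩ := by
  simp only [Sset_comp_even_eq_iff hx, mem_Sodd_iff]
  constructor
  · intro H i _ t
    have := H t
    omega
  · intro H t
    have h₁ (i : ℕ) : (t : ℕ) ≤ 2 * i ↔ (π t : ℕ) ≤ 2 * i := by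
      by_cases hi : i < k
      · exact H i hi t
      · omega
    have := h₁ (((t : ℕ) + 1) / 2)
    have := h₁ (((π t : ℕ) + 1) / 2)
    omega

/-- There is an element of `Seven k` interchanging exactly the blocks selected by `P`. -/
theorem exists_mem_Seven_apply_even {k : ℕ} (P : ℕ → Prop) :
    ∃ τ ∈ Seven k, ∀ i, ∀ h : i < k,
      (P i → τ ⟨2 * i, by omega⟩ = ⟨2 * i + 1, by omega⟩) ∧
      (¬ P i → τ ⟨2 * i, by omega⟩ = ⟨2 * i, by omega⟩) := by
  classical
  let f (j : Fin (2 * k)) : Fin (2 * k) :=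
    ⟨if P ((j : ℕ) / 2) then 4 * ((j : ℕ) / 2) + 1 - j else j, by split_ifs <;> omega⟩
  have hf (j : Fin (2 * k)) : (f j : ℕ) / 2 = (j : ℕ) / 2 := by
    simp only [f]
    split_ifs <;> omega
  have hinv : Function.Involutive f := by
    intro j
    ext
    change (if P ((f j : ℕ) / 2) then 4 * ((f j : ℕ) / 2) + 1 - (f j : ℕ) else f j : ℕ) = j
    rw [hf]
    simp only [f]
    split_ifs <;> omega
  refine ⟨hinv.toPerm, mem_Seven_iff.2 hf, fun i h => ⟨fun hP => ?_, fun hP => ?_⟩⟩ <;>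
  · simp [f, hP]
    try omega

theorem exists_perm_comp_eq {k : ℕ} {I : Finset ℕ} (hI : I.card = 2 * k) (x y : PermOn k I) :
    ∃ ρ : Equiv.Perm (Fin (2 * k)), x.1 ∘ ρ = y.1 := by
  have hx : Finset.univ.image x.1 = I :=
    Finset.eq_of_subset_of_card_le (by simpa [Finset.subset_iff] using x.2.2)
      (by rw [Finset.card_image_of_injective _ x.2.1]; simp [hI])
  have (j : Fin (2 * k)) : ∃ t, x.1 t = y.1 j := by
    have := hx.ge (y.2.2 j)
    simpa using this
  choose f hf using this
  have hinj : Function.Injective f := fun a b h => y.2.1 (by rw [← hf, ← hf, h])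
  exact ⟨Equiv.ofBijective f (Finite.injective_iff_bijective.1 hinj), funext hf⟩

theorem subordinate_iff_exists_Seven {k : ℕ} {x y : Fin (2 * k) → ℕ} :
    Subordinate k x y ↔ ∃ τ ∈ Seven k, ∀ i, ∀ h : i < k,
      Sset k (y ∘ τ) ⟨2 * i, by omega⟩ = Sset k x ⟨2 * i, by omega⟩ := by
  constructor
  · intro H
    obtain ⟨τ, hτ, hP⟩ := exists_mem_Seven_apply_even (k := k) fun i =>
      ∃ h : i < k, Sset k x ⟨2 * i, by omega⟩ ≠ Sset k y ⟨2 * i, by omega⟩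
    refine ⟨τ, hτ, fun i h => ?_⟩
    rw [Sset_comp_of_mem_Seven y hτ]
    by_cases hi : Sset k x ⟨2 * i, by omega⟩ = Sset k y ⟨2 * i, by omega⟩
    · rw [(hP i h).2 (by simp [hi]), hi]
    · rw [(hP i h).1 ⟨h, hi⟩, (H i h).resolve_left hi]
  · rintro ⟨τ, hτ, H⟩ i h
    rw [← H i h, Sset_comp_of_mem_Seven y hτ]
    have hdiv := mem_Seven_iff.1 hτ ⟨2 * i, by omega⟩
    have : τ ⟨2 * i, by omega⟩ = ⟨2 * i, by omega⟩ ∨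
        τ ⟨2 * i, by omega⟩ = ⟨2 * i + 1, by omega⟩ := by
      simp only [Fin.ext_iff] at hdiv ⊢
      omega
    exact this.imp (congrArg _) (congrArg _)

/-- `x` is subordinate to `y` iff there is a unique pair
`(τ, σ) ∈ S^even_{2k} × S^odd_{2k}` with `τ·σ·x = y`
(where `(τ·σ·x)_j = x_{σ(τ(j))}`). -/
theorem statement0 (k : ℕ) (hk : 1 ≤ k) (I : Finset ℕ) (hI : I.card = 2 * k)
    (x y : PermOn k I) :
    Subordinate k x.1 y.1 ↔
      ∃! p : (Seven k) × (Sodd k), ∀ j, x.1 (p.2.1 (p.1.1 j)) = y.1 j := by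
  obtain ⟨ρ, hρ⟩ := exists_perm_comp_eq hI x y
  have key (τ σ : Equiv.Perm (Fin (2 * k))) : (∀ j, x.1 (σ (τ j)) = y.1 j) ↔ σ * τ = ρ := by
    simp only [← hρ, Function.comp_apply, x.2.1.eq_iff, Equiv.ext_iff, Equiv.Perm.mul_apply]
  simp only [key]
  rw [subordinate_iff_exists_Seven]
  constructor
  · rintro ⟨τ, hτ, H⟩
    have hσ : ρ * τ ∈ Sodd k := by
      rw [mem_Sodd_iff_Sset_comp_eq x.2.1, Equiv.Perm.coe_mul, ← Function.comp_assoc, hρ]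
      exact H
    refine ⟨(⟨τ⁻¹, inv_mem hτ⟩, ⟨ρ * τ, hσ⟩), by simp, ?_⟩
    rintro ⟨⟨τ', hτ'⟩, ⟨σ', hσ'⟩⟩ (h : σ' * τ' = ρ)
    have h₁ : τ' * τ = 1 := by
      refine Subgroup.disjoint_def.1 (disjoint_Seven_Sodd k) (mul_mem hτ' hτ) ?_
      have : τ' * τ = σ'⁻¹ * (ρ * τ) := by rw [← h]; group
      exact this ▸ mul_mem (inv_mem hσ') hσ
    simp only [Prod.mk.injEq, Subtype.mk.injEq]
    exact ⟨eq_inv_of_mul_eq_one_left h₁, by rw [← h, mul_assoc, h₁, mul_one]⟩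
  · rintro ⟨⟨⟨τ, hτ⟩, ⟨σ, hσ⟩⟩, h : σ * τ = ρ, -⟩
    refine ⟨τ⁻¹, inv_mem hτ, ?_⟩
    have : x.1 ∘ σ = y.1 ∘ ⇑τ⁻¹ := by
      rw [← hρ, Function.comp_assoc, ← Equiv.Perm.coe_mul, ← h, mul_inv_cancel_right]
    rw [← this]
    exact (mem_Sodd_iff_Sset_comp_eq x.2.1).1 hσ
end

section
/- The map sending an alternating permutation α ∈ Alt_I to the collection of sets {S^α_1, S^α_3, …, S^α_{2k-1}} is injective on Alt_I. -/
/-- At an even `0`-based position `2 * i`, the set `S^x` is the set of the first `2 * i + 1` values. -/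
theorem Sset_even (k : ℕ) (x : Fin (2 * k) → ℕ) (i : ℕ) (h : 2 * i < 2 * k) :
    Sset k x ⟨2 * i, h⟩ = (Finset.Iic (⟨2 * i, h⟩ : Fin (2 * k))).image x := by
  rw [Sset, ← Finset.image_insert]
  congr 1
  ext t
  simp only [Finset.mem_insert, Finset.mem_filter, Finset.mem_univ, true_and, Finset.mem_Iic,
    Fin.ext_iff, Fin.le_def]
  omega

theorem mem_Sset_even {k : ℕ} {x : Fin (2 * k) → ℕ} {i : ℕ} {h : 2 * i < 2 * k} {v : ℕ} :
    v ∈ Sset k x ⟨2 * i, h⟩ ↔ ∃ (j : ℕ) (hj : j < 2 * k), j ≤ 2 * i ∧ x ⟨j, hj⟩ = v := by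
  rw [Sset_even, Finset.mem_image]
  constructor
  · rintro ⟨t, ht, rfl⟩
    exact ⟨t, t.2, Fin.le_def.1 (Finset.mem_Iic.1 ht), rfl⟩
  · rintro ⟨j, hj, hji, rfl⟩
    exact ⟨⟨j, hj⟩, Finset.mem_Iic.2 hji, rfl⟩

theorem card_Sset_even {k : ℕ} {x : Fin (2 * k) → ℕ} (hx : Function.Injective x) (i : ℕ)
    (h : 2 * i < 2 * k) : (Sset k x ⟨2 * i, h⟩).card = 2 * i + 1 := by
  rw [Sset_even, Finset.card_image_of_injective _ hx, Fin.card_Iic]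

/-- For injective tuples, equality of simplices forces equality of the corresponding vertices. -/
theorem Sset_even_eq_of_phiMap_eq {k : ℕ} {x y : Fin (2 * k) → ℕ} (hx : Function.Injective x)
    (hy : Function.Injective y) (h : phiMap k x = phiMap k y) (i : ℕ) (hi : 2 * i < 2 * k) :
    Sset k x ⟨2 * i, hi⟩ = Sset k y ⟨2 * i, hi⟩ := by
  have hmem : Sset k x ⟨2 * i, hi⟩ ∈ phiMap k y := by
    rw [← h]
    exact Finset.mem_image.2 ⟨⟨i, by omega⟩, Finset.mem_univ _, rfl⟩
  obtain ⟨j, -, hj⟩ := Finset.mem_image.1 hmem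
  have hcard := congrArg Finset.card hj
  rw [card_Sset_even hy, card_Sset_even hx] at hcard
  obtain rfl : (j : ℕ) = i := by omega
  exact hj.symm

/-- If `x` and `y` agree below position `n` and the value of `x` at a position `m ≥ n` is among the
first `2 * i + 1` values of `y`, then it is a value of `y` at a position in `[n, 2 * i]`. -/
theorem exists_eq_of_agree_below {k : ℕ} {x y : Fin (2 * k) → ℕ} (hx : Function.Injective x)
    {n m i : ℕ} {hi : 2 * i < 2 * k} (hm : m < 2 * k) (hnm : n ≤ m)
    (hagree : ∀ j, ∀ hj : j < 2 * k, j < n → x ⟨j, hj⟩ = y ⟨j, hj⟩)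
    (hmem : x ⟨m, hm⟩ ∈ Sset k y ⟨2 * i, hi⟩) :
    ∃ (j : ℕ) (hj : j < 2 * k), n ≤ j ∧ j ≤ 2 * i ∧ y ⟨j, hj⟩ = x ⟨m, hm⟩ := by
  obtain ⟨j, hj, hji, hjm⟩ := mem_Sset_even.1 hmem
  refine ⟨j, hj, ?_, hji, hjm⟩
  by_contra! hlt
  have := congrArg Fin.val (hx ((hagree j hj hlt).trans hjm))
  simp only at this
  omega

/-- Alternating injective tuples with the same simplex agree up to each even position. -/
theorem IsAlt.eq_of_le_even {k : ℕ} {x y : Fin (2 * k) → ℕ} (hx : Function.Injective x)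
    (hy : Function.Injective y) (hxa : IsAlt k x) (hya : IsAlt k y)
    (h : phiMap k x = phiMap k y) (i : ℕ) (hi : i < k) :
    ∀ j, ∀ hj : j < 2 * k, j < 2 * i + 1 → x ⟨j, hj⟩ = y ⟨j, hj⟩ := by
  have hS := Sset_even_eq_of_phiMap_eq hx hy h
  induction i with
  | zero =>
    intro j hj hj0
    have hmem : x ⟨j, hj⟩ ∈ Sset k y ⟨2 * 0, by omega⟩ := by
      rw [← hS]
      exact mem_Sset_even.2 ⟨j, hj, by omega, rfl⟩
    obtain ⟨j', hj', hle, he⟩ := mem_Sset_even.1 hmem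
    obtain rfl : j' = j := by omega
    exact he.symm
  | succ i ih =>
    have ih := ih (by omega)
    have hval : ∀ m, ∀ hm : m < 2 * k, 2 * i + 1 ≤ m → m ≤ 2 * i + 2 →
        x ⟨m, hm⟩ = y ⟨2 * i + 1, by omega⟩ ∨ x ⟨m, hm⟩ = y ⟨2 * i + 2, by omega⟩ := by
      intro m hm h1 h2
      have hmem : x ⟨m, hm⟩ ∈ Sset k y ⟨2 * (i + 1), by omega⟩ := by
        rw [← hS]
        exact mem_Sset_even.2 ⟨m, hm, by omega, rfl⟩
      obtain ⟨j, hj, hj1, hj2, he⟩ := exists_eq_of_agree_below hx hm h1 ih hmem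
      obtain rfl | rfl : j = 2 * i + 1 ∨ j = 2 * i + 2 := by omega
      · exact Or.inl he.symm
      · exact Or.inr he.symm
    have h1 := hval (2 * i + 1) (by omega) (by omega) (by omega)
    have h2 := hval (2 * i + 2) (by omega) (by omega) (by omega)
    have hxlt := hxa.2 i hi
    have hylt := hya.2 i hi
    intro j hj hji
    by_cases hjle : j < 2 * i + 1
    · exact ih j hj hjle
    · obtain rfl | rfl : j = 2 * i + 1 ∨ j = 2 * i + 2 := by omega
      · omega
      · omega

/-- `α ↦ {S^α_1, S^α_3, …, S^α_{2k-1}}` is injective on `Alt_I`. -/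
theorem statement3 (k : ℕ) (hk : 1 ≤ k) (I : Finset ℕ) (hI : I.card = 2 * k)
    (α β : PermOn k I) (hα : IsAlt k α.1) (hβ : IsAlt k β.1)
    (h : phiMap k α.1 = phiMap k β.1) :
    α = β := by
  obtain ⟨x, hx, hxI⟩ := α
  obtain ⟨y, hy, hyI⟩ := β
  have hagree : ∀ j, ∀ hj : j < 2 * k, j < 2 * k - 1 → x ⟨j, hj⟩ = y ⟨j, hj⟩ :=
    fun j hj hlt => IsAlt.eq_of_le_even hx hy hα hβ h (k - 1) (by omega) j hj (by omega)
  have himage : Finset.univ.image y = I := by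
    refine Finset.eq_of_subset_of_card_le (Finset.image_subset_iff.2 fun i _ => hyI i) ?_
    rw [Finset.card_image_of_injective _ hy, Finset.card_univ, Fintype.card_fin, hI]
  refine Subtype.ext (funext fun ⟨j, hj⟩ => ?_)
  by_cases hlt : j < 2 * k - 1
  · exact hagree j hj hlt
  · obtain ⟨⟨t, ht⟩, -, he⟩ := Finset.mem_image.1 (himage ▸ hxI ⟨j, hj⟩)
    by_cases htl : t < 2 * k - 1
    · have := congrArg Fin.val (hx ((hagree t ht htl).trans he))
      simp only at this
      omega
    · obtain rfl : t = j := by omega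
      exact he.symm
end

section
/- The family of chains (c(α))_{α ∈ Alt_I}, indexed by the alternating permutations on I, is linearly independent over ℚ. -/
/-- The values of `x` in its first `m` blocks. -/
def blockPrefix (k : ℕ) (x : Fin (2 * k) → ℕ) (m : ℕ) : Finset ℕ :=
  (Finset.univ.filter (fun t : Fin (2 * k) => (t : ℕ) < 2 * m)).image x

section blockPrefix

variable {k : ℕ} {x y : Fin (2 * k) → ℕ}

lemma mem_blockPrefix {m v : ℕ} :
    v ∈ blockPrefix k x m ↔ ∃ j : Fin (2 * k), (j : ℕ) < 2 * m ∧ x j = v := by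
  simp [blockPrefix]

lemma apply_mem_blockPrefix (hx : Function.Injective x) {m : ℕ} {j : Fin (2 * k)} :
    x j ∈ blockPrefix k x m ↔ (j : ℕ) < 2 * m := by
  rw [mem_blockPrefix]
  exact ⟨fun ⟨i, hi, h⟩ => hx h ▸ hi, fun h => ⟨j, h, rfl⟩⟩

lemma card_blockPrefix (hx : Function.Injective x) {m : ℕ} (hm : m ≤ k) :
    (blockPrefix k x m).card = 2 * m := by
  rw [blockPrefix, Finset.card_image_of_injective _ hx, Fin.card_filter_val_lt]
  omega

lemma Sset_eq (i e : ℕ) (he : e < 2) (h : 2 * i + e < 2 * k) :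
    Sset k x ⟨2 * i + e, h⟩ = insert (x ⟨2 * i + e, h⟩) (blockPrefix k x i) := by
  have : (2 * i + e) / 2 = i := by omega
  simp only [Sset, blockPrefix, this]

lemma card_Sset (hx : Function.Injective x) (i e : ℕ) (he : e < 2) (h : 2 * i + e < 2 * k) :
    (Sset k x ⟨2 * i + e, h⟩).card = 2 * i + 1 := by
  rw [Sset_eq i e he h, Finset.card_insert_of_notMem, card_blockPrefix hx (by omega)]
  rw [apply_mem_blockPrefix hx]
  simp

/-- The members of a face are determined by the face, since they have distinct cardinalities. -/
lemma exists_insert_eq_of_Fface_eq (hx : Function.Injective x) (hy : Function.Injective y)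
    {ε δ : Fin k → Bool} (h : Fface k x ε = Fface k y δ) (i : ℕ) (hi : i < k) :
    insert (x ⟨2 * i + (if ε ⟨i, hi⟩ then 1 else 0), by split <;> omega⟩) (blockPrefix k x i) =
      insert (y ⟨2 * i + (if δ ⟨i, hi⟩ then 1 else 0), by split <;> omega⟩)
        (blockPrefix k y i) := by
  have hmem : Sset k x ⟨2 * i + (if ε ⟨i, hi⟩ then 1 else 0), by split <;> omega⟩ ∈
      Fface k y δ := by
    rw [← h]
    exact Finset.mem_image.2 ⟨⟨i, hi⟩, Finset.mem_univ _, rfl⟩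
  obtain ⟨⟨j, hj⟩, -, hij⟩ := Finset.mem_image.1 hmem
  have hcard := congrArg Finset.card hij
  simp only at hcard
  rw [card_Sset hy _ _ (by split <;> omega), card_Sset hx _ _ (by split <;> omega)] at hcard
  obtain rfl : j = i := by omega
  simp only at hij
  rw [Sset_eq _ _ (by split <;> omega), Sset_eq _ _ (by split <;> omega)] at hij
  exact hij.symm

lemma eq_of_Fface_eq (hx : Function.Injective x) {ε δ : Fin k → Bool}
    (h : Fface k x ε = Fface k x δ) : ε = δ := by
  funext ⟨i, hi⟩
  have hins := exists_insert_eq_of_Fface_eq hx hx h i hi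
  have hmem := hins ▸ Finset.mem_insert_self _ _
  rw [Finset.mem_insert, apply_mem_blockPrefix hx, hx.eq_iff, Fin.mk.injEq] at hmem
  revert hmem
  cases ε ⟨i, hi⟩ <;> cases δ ⟨i, hi⟩ <;> simp

lemma chain_apply (F : Finset (Finset ℕ)) :
    chain k x F = ∑ ε : Fin k → Bool,
      if Fface k x ε = F then (-1 : ℚ) ^ (∑ i : Fin k, (ε i).toNat) else 0 := by
  simp [chain, Finsupp.finsetSum_apply, Finsupp.single_apply]

lemma chain_apply_Fface_false (hx : Function.Injective x) :
    chain k x (Fface k x fun _ => false) = 1 := by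
  rw [chain_apply, Finset.sum_eq_single fun _ => false]
  · simp
  · intro ε _ hε
    exact if_neg fun h => hε (eq_of_Fface_eq hx h)
  · simp

lemma exists_Fface_eq_of_chain_apply_ne_zero {F : Finset (Finset ℕ)} (h : chain k x F ≠ 0) :
    ∃ ε, Fface k x ε = F := by
  contrapose! h
  rw [chain_apply]
  exact Finset.sum_eq_zero fun ε _ => if_neg (h ε)

lemma apply_le_of_insert_blockPrefix_eq (hy : Function.Injective y) (ay : IsAlt k y)
    (hsub : ∀ i, ∀ hi : i < k,
      insert (y ⟨2 * i, by omega⟩) (blockPrefix k y i) ⊆ blockPrefix k x (i + 1))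
    {m c : ℕ} (hm : m < k) (hc : c ∉ blockPrefix k x m)
    (hmem : c ∈ insert (y ⟨2 * m, by omega⟩) (blockPrefix k y m)) :
    y ⟨2 * m, by omega⟩ ≤ c := by
  rcases Finset.mem_insert.1 hmem with rfl | hmem
  · exact le_rfl
  obtain ⟨⟨j, hj⟩, hjm, rfl⟩ := mem_blockPrefix.1 hmem
  simp only at hjm
  obtain _ | n := m
  · omega
  have hlt := ay.2 n hm
  by_cases hjn : j = 2 * n + 1
  · subst hjn
    exact hlt.le
  · refine absurd (hsub n (by omega) ?_) hc
    rw [Finset.mem_insert, apply_mem_blockPrefix hy, hy.eq_iff, Fin.mk.injEq]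
    simp only
    omega

lemma blockPrefix_succ (m : ℕ) (hm : m < k) :
    blockPrefix k x (m + 1) =
      insert (x ⟨2 * m, by omega⟩) (insert (x ⟨2 * m + 1, by omega⟩) (blockPrefix k x m)) := by
  ext v
  simp only [Finset.mem_insert, mem_blockPrefix]
  constructor
  · rintro ⟨⟨j, hj⟩, hjm, rfl⟩
    simp only at hjm
    by_cases h0 : j = 2 * m
    · subst h0; exact Or.inl rfl
    by_cases h1 : j = 2 * m + 1
    · subst h1; exact Or.inr (Or.inl rfl)
    · exact Or.inr (Or.inr ⟨⟨j, hj⟩, by simp only; omega, rfl⟩)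
  · rintro (rfl | rfl | ⟨j, hj, rfl⟩)
    · exact ⟨_, by simp only; omega, rfl⟩
    · exact ⟨_, by simp only; omega, rfl⟩
    · exact ⟨j, by omega, rfl⟩

/-- An alternating permutation is determined by its block prefixes. -/
lemma eq_of_blockPrefix_eq (hx : Function.Injective x) (hy : Function.Injective y)
    (ax : IsAlt k x) (ay : IsAlt k y)
    (h : ∀ m ≤ k, blockPrefix k x m = blockPrefix k y m) : x = y := by
  have key : ∀ m, ∀ hm : m < k, x ⟨2 * m, by omega⟩ = y ⟨2 * m, by omega⟩ ∧
      x ⟨2 * m + 1, by omega⟩ = y ⟨2 * m + 1, by omega⟩ := by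
    intro m hm
    have hlx := ax.1 m hm
    have hly := ay.1 m hm
    have hs := h (m + 1) hm
    have h0 := h m hm.le
    have x0 : x ⟨2 * m, by omega⟩ ∉ blockPrefix k y m := by
      rw [← h0, apply_mem_blockPrefix hx]; simp
    have x1 : x ⟨2 * m + 1, by omega⟩ ∉ blockPrefix k y m := by
      rw [← h0, apply_mem_blockPrefix hx]; simp
    have y0 : y ⟨2 * m, by omega⟩ ∉ blockPrefix k y m := by
      rw [apply_mem_blockPrefix hy]; simp
    have y1 : y ⟨2 * m + 1, by omega⟩ ∉ blockPrefix k y m := by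
      rw [apply_mem_blockPrefix hy]; simp
    rw [blockPrefix_succ m hm, blockPrefix_succ m hm, h0] at hs
    have ex0 := Finset.ext_iff.1 hs (x ⟨2 * m, by omega⟩)
    have ex1 := Finset.ext_iff.1 hs (x ⟨2 * m + 1, by omega⟩)
    simp only [Finset.mem_insert, x0, x1, true_or, or_true, or_false, true_iff] at ex0 ex1
    omega
  funext ⟨j, hj⟩
  obtain ⟨m, rfl | rfl⟩ := Nat.even_or_odd' j
  · exact (key m (by omega)).1
  · exact (key m (by omega)).2

/-- If the face of `y` occurs in the chain of `x`, then the block prefixes of `y` have larger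
sums than those of `x`, with equality only when they agree. -/
lemma sum_blockPrefix_le (hx : Function.Injective x) (hy : Function.Injective y)
    (ay : IsAlt k y) {ε : Fin k → Bool} (h : Fface k x ε = Fface k y fun _ => false)
    {m : ℕ} (hm : m < k) :
    ∑ v ∈ blockPrefix k x m, v ≤ ∑ v ∈ blockPrefix k y m, v ∧
      (∑ v ∈ blockPrefix k x m, v = ∑ v ∈ blockPrefix k y m, v →
        blockPrefix k x m = blockPrefix k y m) := by
  have hins := exists_insert_eq_of_Fface_eq hx hy h
  simp only [Bool.false_eq_true, if_false, Nat.add_zero] at hins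
  have hsub : ∀ i, ∀ hi : i < k,
      insert (y ⟨2 * i, by omega⟩) (blockPrefix k y i) ⊆ blockPrefix k x (i + 1) := by
    intro i hi
    rw [← hins i hi, blockPrefix_succ i hi]
    cases ε ⟨i, hi⟩ <;> intro v <;> simp <;> tauto
  have hmx : x ⟨2 * m + (if ε ⟨m, hm⟩ then 1 else 0), by split <;> omega⟩ ∉
      blockPrefix k x m := by
    rw [apply_mem_blockPrefix hx]; simp
  have hmy : y ⟨2 * m, by omega⟩ ∉ blockPrefix k y m := by
    rw [apply_mem_blockPrefix hy]; simp
  have hle := apply_le_of_insert_blockPrefix_eq hy ay hsub hm hmx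
    (hins m hm ▸ Finset.mem_insert_self _ _)
  have hsum := congrArg (fun s => ∑ v ∈ s, v) (hins m hm)
  rw [Finset.sum_insert hmx, Finset.sum_insert hmy] at hsum
  refine ⟨by omega, fun heq => ?_⟩
  have hcy : x ⟨2 * m + (if ε ⟨m, hm⟩ then 1 else 0), by split <;> omega⟩ =
      y ⟨2 * m, by omega⟩ := by omega
  rw [← Finset.erase_insert hmx, hins m hm, hcy, Finset.erase_insert hmy]

/-- A statistic for which the matrix of the chains of alternating permutations is triangular. -/
def prefixWeight (k : ℕ) (x : Fin (2 * k) → ℕ) : ℕ :=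
  ∑ m ∈ Finset.range k, ∑ v ∈ blockPrefix k x m, v

lemma blockPrefix_self_eq {I : Finset ℕ} (hI : I.card = 2 * k) (hx : Function.Injective x)
    (hxI : ∀ i, x i ∈ I) : blockPrefix k x k = I := by
  refine Finset.eq_of_subset_of_card_le ?_ ?_
  · intro v hv
    obtain ⟨j, -, rfl⟩ := mem_blockPrefix.1 hv
    exact hxI j
  · rw [hI, card_blockPrefix hx le_rfl]

lemma eq_or_prefixWeight_lt {I : Finset ℕ} (hI : I.card = 2 * k)
    (hx : Function.Injective x) (hxI : ∀ i, x i ∈ I)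
    (hy : Function.Injective y) (hyI : ∀ i, y i ∈ I) (ax : IsAlt k x) (ay : IsAlt k y)
    (h : chain k x (Fface k y fun _ => false) ≠ 0) :
    x = y ∨ prefixWeight k x < prefixWeight k y := by
  obtain ⟨ε, hε⟩ := exists_Fface_eq_of_chain_apply_ne_zero h
  have hle : ∀ m ∈ Finset.range k, ∑ v ∈ blockPrefix k x m, v ≤ ∑ v ∈ blockPrefix k y m, v :=
    fun m hm => (sum_blockPrefix_le hx hy ay hε (Finset.mem_range.1 hm)).1
  refine (Finset.sum_le_sum hle).lt_or_eq.symm.imp_left fun heq => ?_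
  refine eq_of_blockPrefix_eq hx hy ax ay fun m hm => ?_
  rcases hm.lt_or_eq with hm | rfl
  · exact (sum_blockPrefix_le hx hy ay hε hm).2
      ((Finset.sum_eq_sum_iff_of_le hle).1 heq m (Finset.mem_range.2 hm))
  · rw [blockPrefix_self_eq hI hx hxI, blockPrefix_self_eq hI hy hyI]

end blockPrefix

/-- A family is linearly independent if it is triangular, with nonzero diagonal, with respect to
some linear functionals and an `ℕ`-valued statistic. -/
lemma linearIndependent_of_triangular {ι R M : Type*} [Ring R] [NoZeroDivisors R]
    [AddCommGroup M] [Module R M] (v : ι → M) (φ : ι → M →ₗ[R] R) (f : ι → ℕ)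
    (hdiag : ∀ i, φ i (v i) ≠ 0) (htri : ∀ i j, φ j (v i) ≠ 0 → i = j ∨ f i < f j) :
    LinearIndependent R v := by
  classical
  rw [linearIndependent_iff']
  intro s g hg
  by_contra! hne
  obtain ⟨i, his, hi⟩ := hne
  obtain ⟨j, hj, hmin⟩ := (s.filter (g · ≠ 0)).exists_min_image f
    ⟨i, Finset.mem_filter.2 ⟨his, hi⟩⟩
  rw [Finset.mem_filter] at hj
  have h0 := congrArg (φ j) hg
  rw [map_sum, map_zero, Finset.sum_eq_single j] at h0
  · rw [map_smul, smul_eq_mul] at h0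
    exact mul_ne_zero hj.2 (hdiag j) h0
  · intro l hl hlj
    rw [map_smul, smul_eq_mul]
    by_contra hprod
    have hlt := (htri l j (right_ne_zero_of_mul hprod)).resolve_left hlj
    exact hlt.not_ge (hmin l (Finset.mem_filter.2 ⟨hl, left_ne_zero_of_mul hprod⟩))
  · exact fun h => absurd hj.1 h

/-- The chains `(c(α))_{α ∈ Alt_I}` are linearly independent over `ℚ`. -/
theorem statement4 (k : ℕ) (hk : 1 ≤ k) (I : Finset ℕ) (hI : I.card = 2 * k) :
    LinearIndependent ℚ (fun a : {a : PermOn k I // IsAlt k a.1} => chain k a.1.1) := by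
  exact linearIndependent_of_triangular _
    (fun b => Finsupp.lapply (Fface k b.1.1 fun _ => false)) (fun a => prefixWeight k a.1.1)
    (fun a => by
      rw [Finsupp.lapply_apply, chain_apply_Fface_false a.1.2.1]
      exact one_ne_zero)
    (fun a b h => (eq_or_prefixWeight_lt hI a.1.2.1 a.1.2.2 b.1.2.1 b.1.2.2 a.2 b.2 h).imp_left
      fun hab => Subtype.ext (Subtype.ext hab))
end

section
/- For every x ∈ Perm_I and 1 ≤ i ≤ k, if x' denotes the permutation agreeing with x except that the values at positions 2i-1 and 2i are interchanged, then c(x') = −c(x). -/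
theorem swap_block_div_two (n i : ℕ) (h₀ : 2 * i < n) (h₁ : 2 * i + 1 < n) (j : Fin n) :
    (Equiv.swap (⟨2 * i, h₀⟩ : Fin n) ⟨2 * i + 1, h₁⟩ j : ℕ) / 2 = (j : ℕ) / 2 := by
  rw [Equiv.swap_apply_def]
  split_ifs with h h <;> simp_all <;> omega

/-- Precomposing with a permutation that preserves blocks moves the index of `Sset`. -/
theorem Sset_comp_perm (k : ℕ) (x : Fin (2 * k) → ℕ) (σ : Equiv.Perm (Fin (2 * k)))
    (hσ : ∀ j, (σ j : ℕ) / 2 = (j : ℕ) / 2) (j : Fin (2 * k)) :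
    Sset k (x ∘ σ) j = Sset k x (σ j) := by
  unfold Sset
  rw [hσ, ← Finset.image_image]
  congr 2
  ext t
  simp only [Finset.mem_image, Finset.mem_filter, Finset.mem_univ, true_and]
  constructor
  · rintro ⟨s, hs, rfl⟩
    have := hσ s
    omega
  · intro ht
    refine ⟨σ.symm t, ?_, σ.apply_symm_apply t⟩
    have := hσ (σ.symm t)
    rw [σ.apply_symm_apply] at this
    omega

/-- Negation of the `i`-th coordinate of a Boolean vector. -/
def flipAt {k : ℕ} (i : Fin k) (ε : Fin k → Bool) : Fin k → Bool :=
  Function.update ε i (!ε i)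

theorem flipAt_involutive {k : ℕ} (i : Fin k) : Function.Involutive (flipAt i) := by
  intro ε
  simp [flipAt]

theorem neg_one_pow_sum_flipAt {k : ℕ} (i : Fin k) (ε : Fin k → Bool) :
    (-1 : ℚ) ^ (∑ j, (flipAt i ε j).toNat) = -(-1 : ℚ) ^ (∑ j, (ε j).toNat) := by
  rw [← Finset.add_sum_erase _ _ (Finset.mem_univ i),
    ← Finset.add_sum_erase _ (fun j => (ε j).toNat) (Finset.mem_univ i)]
  have h : ∑ j ∈ Finset.univ.erase i, (flipAt i ε j).toNat =
      ∑ j ∈ Finset.univ.erase i, (ε j).toNat :=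
    Finset.sum_congr rfl fun j hj => by simp [flipAt, Finset.ne_of_mem_erase hj]
  rw [h, pow_add, pow_add]
  cases hi : ε i <;> simp [flipAt, hi]

theorem Fface_comp_swap (k : ℕ) (x : Fin (2 * k) → ℕ) (i : ℕ) (hi : i < k)
    (ε : Fin k → Bool) :
    Fface k (x ∘ Equiv.swap (⟨2 * i, by omega⟩ : Fin (2 * k)) ⟨2 * i + 1, by omega⟩) ε =
      Fface k x (flipAt ⟨i, hi⟩ ε) := by
  unfold Fface
  congr 1
  funext j
  rw [Sset_comp_perm k x _ (swap_block_div_two _ i _ _)]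
  congr 1
  rw [Equiv.swap_apply_def]
  by_cases hj : j = ⟨i, hi⟩
  · subst hj
    rcases Bool.eq_false_or_eq_true (ε ⟨i, hi⟩) with h | h <;> simp [flipAt, h]
  · have hne : (j : ℕ) ≠ i := fun h => hj (Fin.ext h)
    simp only [flipAt, Function.update_of_ne hj, Fin.ext_iff]
    split_ifs <;> first | rfl | omega

/-- Interchanging the values of `x` at the positions `2i-1, 2i`
negates the chain: `c(x') = −c(x)`. -/
theorem statement5 (k : ℕ) (hk : 1 ≤ k) (I : Finset ℕ) (hI : I.card = 2 * k)
    (x x' : PermOn k I) (i : ℕ) (hi : i < k)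
    (hx' : x'.1 =
      x.1 ∘ (Equiv.swap (⟨2 * i, by omega⟩ : Fin (2 * k)) ⟨2 * i + 1, by omega⟩)) :
    chain k x'.1 = - chain k x.1 := by
  rw [hx', chain, chain, ← Finset.sum_neg_distrib]
  refine Fintype.sum_equiv (flipAt_involutive ⟨i, hi⟩).toPerm _ _ fun ε => ?_
  rw [Fface_comp_swap k x.1 i hi, Function.Involutive.coe_toPerm, neg_one_pow_sum_flipAt,
    neg_smul, neg_neg]
end

section
/- The quotient ℚ⟨Perm_I⟩/M_I is spanned by the images of the alternating permutations: for every x ∈ Perm_I there exist rationals (q_α)_{α ∈ Alt_I} such that x − Σ_{α ∈ Alt_I} q_α·α ∈ M_I. -/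
/-- The position-weighted sum of the values of `x`. The weights `1, 0, 3, 2, 5, 4, …` are chosen so
that it decreases both when a block is sorted and when a Garnir element is used to rewrite a
permutation with an ascent between two sorted blocks. -/
def weightedSum (k : ℕ) (x : Fin (2 * k) → ℕ) : ℕ :=
  ∑ j : Fin (2 * k), (if (j : ℕ) % 2 = 0 then (j : ℕ) + 1 else (j : ℕ) - 1) * x j

theorem weightedSum_lt_of_eqOn_compl {k : ℕ} {x y : Fin (2 * k) → ℕ} (T : Finset (Fin (2 * k)))
    (hout : ∀ j, j ∉ T → y j = x j)
    (hlt : ∑ j ∈ T, (if (j : ℕ) % 2 = 0 then (j : ℕ) + 1 else (j : ℕ) - 1) * y j <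
      ∑ j ∈ T, (if (j : ℕ) % 2 = 0 then (j : ℕ) + 1 else (j : ℕ) - 1) * x j) :
    weightedSum k y < weightedSum k x := by
  unfold weightedSum
  rw [← Finset.sum_add_sum_compl T, ← Finset.sum_add_sum_compl T (fun j => _ * x j)]
  have h : ∑ j ∈ Tᶜ, (if (j : ℕ) % 2 = 0 then (j : ℕ) + 1 else (j : ℕ) - 1) * y j =
      ∑ j ∈ Tᶜ, (if (j : ℕ) % 2 = 0 then (j : ℕ) + 1 else (j : ℕ) - 1) * x j :=
    Finset.sum_congr rfl fun j hj => by rw [hout j (Finset.mem_compl.mp hj)]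
  omega

theorem weightedSum_comp_swap_lt {k : ℕ} {x : Fin (2 * k) → ℕ} {i : ℕ} (h : i < k)
    (hx : x ⟨2 * i + 1, by omega⟩ < x ⟨2 * i, by omega⟩) :
    weightedSum k (x ∘ Equiv.swap (⟨2 * i, by omega⟩ : Fin (2 * k)) ⟨2 * i + 1, by omega⟩) <
      weightedSum k x := by
  refine weightedSum_lt_of_eqOn_compl {⟨2 * i, by omega⟩, ⟨2 * i + 1, by omega⟩} ?_ ?_
  · intro j hj
    simp only [Finset.mem_insert, Finset.mem_singleton, not_or] at hj
    simp [Equiv.swap_apply_of_ne_of_ne hj.1 hj.2]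
  · rw [Finset.sum_pair (by simp), Finset.sum_pair (by simp)]
    simp [Nat.add_mod]
    nlinarith

theorem weightedSum_set4_lt {k : ℕ} {x : Fin (2 * k) → ℕ} {i p q r s : ℕ} (h : i + 1 < k)
    (hlt : (2 * i + 1) * p + 2 * i * q + (2 * i + 3) * r + (2 * i + 2) * s <
      (2 * i + 1) * x ⟨2 * i, by omega⟩ + 2 * i * x ⟨2 * i + 1, by omega⟩ +
        (2 * i + 3) * x ⟨2 * i + 2, by omega⟩ + (2 * i + 2) * x ⟨2 * i + 3, by omega⟩) :
    weightedSum k (set4 k x i p q r s) < weightedSum k x := by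
  refine weightedSum_lt_of_eqOn_compl {⟨2 * i, by omega⟩, ⟨2 * i + 1, by omega⟩,
    ⟨2 * i + 2, by omega⟩, ⟨2 * i + 3, by omega⟩} ?_ ?_
  · intro j hj
    simp only [Finset.mem_insert, Finset.mem_singleton, not_or, Fin.ext_iff] at hj
    simp [set4, hj]
  · have sum4 (f : Fin (2 * k) → ℕ) :
        ∑ j ∈ ({⟨2 * i, by omega⟩, ⟨2 * i + 1, by omega⟩, ⟨2 * i + 2, by omega⟩,
          ⟨2 * i + 3, by omega⟩} : Finset (Fin (2 * k))), f j =
        f ⟨2 * i, by omega⟩ + f ⟨2 * i + 1, by omega⟩ + f ⟨2 * i + 2, by omega⟩ +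
          f ⟨2 * i + 3, by omega⟩ := by
      rw [Finset.sum_insert (by simp), Finset.sum_insert (by simp), Finset.sum_pair (by simp)]
      ring
    rw [sum4, sum4]
    simpa [set4, Nat.add_mod] using hlt

/-- The permutation obtained from `x` by replacing the values at positions `2i, …, 2i+3` by those at
the pairwise distinct positions `e₀, …, e₃`, taken from the same range. -/
def PermOn.rearrange {k : ℕ} {I : Finset ℕ} (x : PermOn k I) (i : ℕ) (e₀ e₁ e₂ e₃ : Fin (2 * k))
    (hmem : ∀ e ∈ [e₀, e₁, e₂, e₃], 2 * i ≤ (e : ℕ) ∧ (e : ℕ) ≤ 2 * i + 3)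
    (hne : [e₀, e₁, e₂, e₃].Nodup) : PermOn k I :=
  ⟨set4 k x.1 i (x.1 e₀) (x.1 e₁) (x.1 e₂) (x.1 e₃), by
    have hset : set4 k x.1 i (x.1 e₀) (x.1 e₁) (x.1 e₂) (x.1 e₃) = x.1 ∘ fun j : Fin (2 * k) =>
        if (j : ℕ) = 2 * i then e₀ else if (j : ℕ) = 2 * i + 1 then e₁
        else if (j : ℕ) = 2 * i + 2 then e₂ else if (j : ℕ) = 2 * i + 3 then e₃ else j := by
      funext j
      simp only [set4, Function.comp_apply]
      split_ifs <;> rfl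
    rw [hset]
    refine ⟨x.2.1.comp ?_, fun j => x.2.2 _⟩
    intro a b hab
    simp only [List.nodup_cons, List.mem_cons, Fin.ext_iff] at hmem hne
    simp only [Fin.ext_iff] at hab ⊢
    split_ifs at hab <;> grind⟩

theorem single_mem_sup_supported_isAlt (k : ℕ) (I : Finset ℕ) (x : PermOn k I) :
    Finsupp.single x (1 : ℚ) ∈ MI k I ⊔ Finsupp.supported ℚ ℚ {a : PermOn k I | IsAlt k a.1} := by
  induction hn : weightedSum k x.1 using Nat.strong_induction_on generalizing x with
  | _ n ih =>
  subst hn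
  by_cases hsort : ∀ i : ℕ, ∀ h : i < k, x.1 ⟨2 * i, by omega⟩ < x.1 ⟨2 * i + 1, by omega⟩
  · by_cases hdesc : ∀ i : ℕ, ∀ h : i + 1 < k, x.1 ⟨2 * i + 2, by omega⟩ < x.1 ⟨2 * i + 1, by omega⟩
    · exact Submodule.mem_sup_right (Finsupp.single_mem_supported ℚ 1 ⟨hsort, hdesc⟩)
    · push Not at hdesc
      obtain ⟨i, h, hi⟩ := hdesc
      have hbc : x.1 ⟨2 * i + 1, by omega⟩ < x.1 ⟨2 * i + 2, by omega⟩ :=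
        lt_of_le_of_ne hi fun he => by simpa using x.2.1 he
      have hab := hsort i (by omega)
      have hcd : x.1 ⟨2 * i + 2, by omega⟩ < x.1 ⟨2 * i + 3, by omega⟩ := hsort (i + 1) h
      let e (t : Fin 4) : Fin (2 * k) := ⟨2 * i + t, by omega⟩
      let y₁ := x.rearrange i (e 0) (e 2) (e 1) (e 3) (by simp [e]) (by simp [e])
      let y₂ := x.rearrange i (e 0) (e 3) (e 1) (e 2) (by simp [e]) (by simp [e])
      let y₃ := x.rearrange i (e 1) (e 2) (e 0) (e 3) (by simp [e]) (by simp [e])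
      let y₄ := x.rearrange i (e 1) (e 3) (e 0) (e 2) (by simp [e]) (by simp [e])
      let y₅ := x.rearrange i (e 2) (e 3) (e 0) (e 1) (by simp [e]) (by simp [e])
      have hG : Finsupp.single x (1 : ℚ) - Finsupp.single y₁ 1 + Finsupp.single y₂ 1
          + Finsupp.single y₃ 1 - Finsupp.single y₄ 1 + Finsupp.single y₅ 1 ∈ MI k I :=
        Submodule.subset_span (Or.inr ⟨x, y₁, y₂, y₃, y₄, y₅, i, h,
          ⟨rfl, rfl, rfl, rfl, rfl⟩, rfl⟩)
      have h₁ := ih _ (weightedSum_set4_lt h (by simp [e]; nlinarith)) y₁ rfl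
      have h₂ := ih _ (weightedSum_set4_lt h (by simp [e]; nlinarith)) y₂ rfl
      have h₃ := ih _ (weightedSum_set4_lt h (by simp [e]; nlinarith)) y₃ rfl
      have h₄ := ih _ (weightedSum_set4_lt h (by simp [e]; nlinarith)) y₄ rfl
      have h₅ := ih _ (weightedSum_set4_lt h (by simp [e]; nlinarith)) y₅ rfl
      convert Submodule.sub_mem _ (Submodule.add_mem _ (Submodule.sub_mem _ (Submodule.sub_mem _
        (Submodule.add_mem _ (Submodule.mem_sup_left hG) h₁) h₂) h₃) h₄) h₅ using 1
      abel
  · push Not at hsort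
    obtain ⟨i, h, hi⟩ := hsort
    have hlt : x.1 ⟨2 * i + 1, by omega⟩ < x.1 ⟨2 * i, by omega⟩ :=
      lt_of_le_of_ne hi fun he => by simpa using x.2.1 he
    let y : PermOn k I :=
      ⟨x.1 ∘ Equiv.swap (⟨2 * i, by omega⟩ : Fin (2 * k)) ⟨2 * i + 1, by omega⟩,
        x.2.1.comp (Equiv.injective _), fun j => x.2.2 _⟩
    have hS : Finsupp.single x (1 : ℚ) + Finsupp.single y 1 ∈ MI k I :=
      Submodule.subset_span (Or.inl ⟨x, y, i, h, rfl, rfl⟩)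
    have hy := ih _ (weightedSum_comp_swap_lt h hlt) y rfl
    convert Submodule.sub_mem _ (Submodule.mem_sup_left hS) hy using 1
    abel

/-- `ℚ⟨Perm_I⟩/M_I` is spanned by the images of the alternating
permutations: for `x ∈ Perm_I` there are rationals `(q_α)_{α ∈ Alt_I}` with
`x − Σ_α q_α·α ∈ M_I`. -/
theorem statement6 (k : ℕ) (hk : 1 ≤ k) (I : Finset ℕ) (hI : I.card = 2 * k)
    (x : PermOn k I) :
    ∃ q : PermOn k I →₀ ℚ, (∀ a ∈ q.support, IsAlt k a.1) ∧
      Finsupp.single x 1 - q ∈ MI k I := by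
  obtain ⟨m, hm, q, hq, hmq⟩ := Submodule.mem_sup.mp (single_mem_sup_supported_isAlt k I x)
  exact ⟨q, fun a ha => (Finsupp.mem_supported ℚ q).mp hq ha, by rwa [← hmq, add_sub_cancel_right]⟩
end

section
/- For every α ∈ Alt_I and x ∈ Perm_I, the set P_I(α, x) of directed walks from α to x is finite. -/
/-- `S^x_i` with odd `i` consists of the first `i` values of `x`. -/
lemma mem_Sset_two_mul {k : ℕ} {x : Fin (2 * k) → ℕ} {i : ℕ} (h : 2 * i < 2 * k) {a : ℕ} :
    a ∈ Sset k x ⟨2 * i, h⟩ ↔ ∃ t : Fin (2 * k), (t : ℕ) ≤ 2 * i ∧ x t = a := by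
  simp only [Sset, Finset.mem_insert, Finset.mem_image, Finset.mem_filter, Finset.mem_univ,
    true_and]
  constructor
  · rintro (rfl | ⟨t, ht, rfl⟩)
    · exact ⟨_, le_rfl, rfl⟩
    · exact ⟨t, by omega, rfl⟩
  · rintro ⟨t, ht, rfl⟩
    rcases ht.lt_or_eq with ht | ht
    · exact Or.inr ⟨t, by omega, rfl⟩
    · exact Or.inl (congrArg x (Fin.ext ht))

lemma apply_mem_Sset_two_mul_iff {k : ℕ} {x : Fin (2 * k) → ℕ} (hx : Function.Injective x)
    {i : ℕ} (h : 2 * i < 2 * k) (t : Fin (2 * k)) :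
    x t ∈ Sset k x ⟨2 * i, h⟩ ↔ (t : ℕ) ≤ 2 * i := by
  rw [mem_Sset_two_mul]
  constructor
  · rintro ⟨s, hs, hst⟩
    rwa [← hx hst]
  · exact fun ht => ⟨t, ht, rfl⟩

lemma sum_Sset_lt_sum_Sset_succ {k : ℕ} {y : Fin (2 * k) → ℕ} (hy : Function.Injective y)
    (halt : IsAlt k y) {i : ℕ} (h : i < k) :
    ∑ a ∈ Sset k y ⟨2 * i, by omega⟩, a < ∑ a ∈ Sset k y ⟨2 * i + 1, by omega⟩, a := by
  unfold Sset
  rw [Finset.sum_insert, Finset.sum_insert]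
  · have h1 : 2 * (2 * i / 2) = 2 * i := by omega
    have h2 : 2 * ((2 * i + 1) / 2) = 2 * i := by omega
    simp only [h1, h2]
    exact Nat.add_lt_add_right (halt.1 i h) _
  all_goals
    simp only [Finset.mem_image, Finset.mem_filter, Finset.mem_univ, true_and, not_exists, not_and]
    intro t ht hty
    have := congrArg Fin.val (hy hty)
    simp only at this
    omega

lemma apply_le_of_Sset_eq {k : ℕ} {x y : Fin (2 * k) → ℕ} (hx : Function.Injective x)
    (hy : IsAlt k y)
    (hS : ∀ i : ℕ, ∀ h : i < k, Sset k x ⟨2 * i, by omega⟩ = Sset k y ⟨2 * i, by omega⟩)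
    {i : ℕ} (h : i + 1 < k) :
    x ⟨2 * i + 1, by omega⟩ ≤ y ⟨2 * i + 1, by omega⟩ ∧
      y ⟨2 * i + 2, by omega⟩ ≤ x ⟨2 * i + 2, by omega⟩ := by
  have key : ∀ t : Fin (2 * k), 2 * i < (t : ℕ) → (t : ℕ) ≤ 2 * i + 2 →
      x t = y ⟨2 * i + 1, by omega⟩ ∨ x t = y ⟨2 * i + 2, by omega⟩ := by
    intro t ht1 ht2
    have hmem := (apply_mem_Sset_two_mul_iff hx (i := i + 1) (by omega) t).2 (by omega)
    rw [hS (i + 1) h, mem_Sset_two_mul] at hmem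
    obtain ⟨s, hs, hst⟩ := hmem
    have hs' : ¬ (s : ℕ) ≤ 2 * i := by
      intro hle
      have hmem' : x t ∈ Sset k y ⟨2 * i, by omega⟩ :=
        (mem_Sset_two_mul _).2 ⟨s, hle, hst⟩
      rw [← hS i (by omega), apply_mem_Sset_two_mul_iff hx] at hmem'
      omega
    rcases (by omega : (s : ℕ) = 2 * i + 1 ∨ (s : ℕ) = 2 * i + 2) with hv | hv
    · left; rw [← hst]; exact congrArg y (Fin.ext hv)
    · right; rw [← hst]; exact congrArg y (Fin.ext hv)
  have hlt := hy.2 i h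
  have h1 := key ⟨2 * i + 1, by omega⟩ (by simp) (by simp)
  have h2 := key ⟨2 * i + 2, by omega⟩ (by simp) (by simp)
  omega

/-- An alternating permutation is determined by its sets `S^x_1, S^x_3, …, S^x_{2k-1}`. -/
lemma eq_of_Sset_eq {k : ℕ} {I : Finset ℕ} (hI : I.card = 2 * k) {x y : PermOn k I}
    (hx : IsAlt k x.1) (hy : IsAlt k y.1)
    (hS : ∀ i : ℕ, ∀ h : i < k, Sset k x.1 ⟨2 * i, by omega⟩ = Sset k y.1 ⟨2 * i, by omega⟩) :
    x = y := by
  have hS' : ∀ i : ℕ, ∀ h : i < k,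
      Sset k y.1 ⟨2 * i, by omega⟩ = Sset k x.1 ⟨2 * i, by omega⟩ := fun i h => (hS i h).symm
  apply Subtype.ext
  funext ⟨n, hn⟩
  by_cases h0 : n = 0
  · subst h0
    have := (apply_mem_Sset_two_mul_iff x.2.1 (i := 0) (by omega) ⟨0, hn⟩).2 le_rfl
    rw [hS 0 (by omega), mem_Sset_two_mul] at this
    obtain ⟨s, hs, hsx⟩ := this
    rw [← hsx]
    exact congrArg y.1 (Fin.ext (by simpa using hs))
  by_cases hlast : n + 1 = 2 * k
  · have himage : Finset.univ.image y.1 = I := by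
      apply Finset.eq_of_subset_of_card_le
      · intro a ha
        obtain ⟨t, -, rfl⟩ := Finset.mem_image.1 ha
        exact y.2.2 t
      · rw [Finset.card_image_of_injective _ y.2.1, hI, Finset.card_univ, Fintype.card_fin]
    obtain ⟨s, -, hs⟩ := Finset.mem_image.1 (himage.ge (x.2.2 ⟨n, hn⟩))
    have hsn : ¬ (s : ℕ) ≤ 2 * (k - 1) := by
      intro hle
      have hmem' : x.1 ⟨n, hn⟩ ∈ Sset k y.1 ⟨2 * (k - 1), by omega⟩ :=
        (mem_Sset_two_mul _).2 ⟨s, hle, hs⟩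
      rw [← hS (k - 1) (by omega), apply_mem_Sset_two_mul_iff x.2.1] at hmem'
      simp only at hmem'
      omega
    rw [← hs]
    exact congrArg y.1 (Fin.ext (by simp only; omega))
  · obtain ⟨i, hi⟩ : ∃ i, n = 2 * i + 1 ∨ n = 2 * i + 2 := ⟨(n - 1) / 2, by omega⟩
    have h1 := apply_le_of_Sset_eq x.2.1 hy hS (i := i) (by omega)
    have h2 := apply_le_of_Sset_eq y.2.1 hx hS' (i := i) (by omega)
    rcases hi with rfl | rfl
    · exact le_antisymm h1.1 h2.1
    · exact le_antisymm h2.2 h1.2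

/-- The total of the sums of the sets `S^x_1, S^x_3, …, S^x_{2k-1}`. -/
def oddSsetSum (k : ℕ) (x : Fin (2 * k) → ℕ) : ℕ :=
  ∑ i : Fin k, ∑ a ∈ Sset k x ⟨2 * (i : ℕ), by omega⟩, a

lemma oddSsetSum_lt_of_subordinate {k : ℕ} {I : Finset ℕ} (hI : I.card = 2 * k)
    {x y : PermOn k I} (hx : IsAlt k x.1) (hy : IsAlt k y.1) (hxy : Subordinate k x.1 y.1)
    (hne : x ≠ y) : oddSsetSum k y.1 < oddSsetSum k x.1 := by
  have hex : ∃ i : ℕ, ∃ h : i < k,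
      Sset k x.1 ⟨2 * i, by omega⟩ ≠ Sset k y.1 ⟨2 * i, by omega⟩ := by
    by_contra! hcon
    exact hne (eq_of_Sset_eq hI hx hy hcon)
  obtain ⟨i, hi, hSi⟩ := hex
  refine Finset.sum_lt_sum (fun j _ => ?_) ⟨⟨i, hi⟩, Finset.mem_univ _, ?_⟩
  · rcases hxy j j.2 with h | h
    · exact (congrArg (fun s => ∑ a ∈ s, a) h).ge
    · rw [h]
      exact (sum_Sset_lt_sum_Sset_succ y.2.1 hy j.2).le
  · rw [(hxy i hi).resolve_left hSi]
    exact sum_Sset_lt_sum_Sset_succ y.2.1 hy hi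

instance PermOn.finite (k : ℕ) (I : Finset ℕ) : Finite (PermOn k I) :=
  Finite.of_injective (fun (x : PermOn k I) i => (⟨x.1 i, x.2.2 i⟩ : I)) fun _ _ hxy =>
    Subtype.ext <| funext fun i => congrArg Subtype.val (congrFun hxy i)

/-- The length of a directed walk is bounded in terms of its starting point. -/
lemma length_le_of_mem_Walks {k : ℕ} {I : Finset ℕ} (hI : I.card = 2 * k) {α x : PermOn k I}
    {w : (m : ℕ) × (Fin (m + 1) → PermOn k I)} (hw : w ∈ Walks k I α x) :
    w.1 ≤ oddSsetSum k α.1 + 1 := by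
  obtain ⟨hpos, h0, -, hstep, hne⟩ := hw
  have hdesc : ∀ j : ℕ, ∀ h : j < w.1,
      oddSsetSum k (w.2 ⟨j, by omega⟩).1 + j ≤ oddSsetSum k α.1 := by
    intro j
    induction j with
    | zero => intro _; rw [← h0]; exact le_rfl
    | succ j ih =>
      intro h
      have hlt := oddSsetSum_lt_of_subordinate hI (hstep j (by omega)).1 (hstep (j + 1) h).1
        (hstep j (by omega)).2 (hne j h)
      have := ih (by omega)
      omega
  have := hdesc (w.1 - 1) (by omega)
  omega

/-- For `α ∈ Alt_I` and `x ∈ Perm_I`, the set `P_I(α, x)` of directed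
walks from `α` to `x` is finite. -/
theorem statement8 (k : ℕ) (hk : 1 ≤ k) (I : Finset ℕ) (hI : I.card = 2 * k)
    (α x : PermOn k I) (hα : IsAlt k α.1) :
    (Walks k I α x).Finite := by
  have hfin : (⋃ m ∈ Set.Iic (oddSsetSum k α.1 + 1),
      Set.range (Sigma.mk (β := fun m : ℕ => Fin (m + 1) → PermOn k I) m)).Finite :=
    (Set.finite_Iic _).biUnion fun m _ => Set.finite_range _
  refine hfin.subset fun w hw => ?_
  exact Set.mem_biUnion (length_le_of_mem_Walks hI hw) ⟨w.2, rfl⟩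
end
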